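/- Let R be a dense subring of ℝ and let n and K be positive integers. Then there exists a positive integer J such that for every ε > 0 there exists δ > 0 with the following property: for every nilpotent n×n matrix N over R with ‖N‖∞ < δ, there is a J×J matrix M over R such that (1) M is strong shift equivalent over R to N, (2) trace(|M|^k) = 0 for all 1 ≤ k ≤ K, and (3) ‖M‖∞ < ε. -/

import Mathlib

/-- All entries of the matrix `A` lie in the subset `S`. -/
def entriesIn {R : Type*} {m n : ℕ} (S : Set R) (A : Matrix (Fin m) (Fin n) R) : Prop :=
  ∀ i j, A i j ∈ S

/-- Elementary strong shift equivalence over the subset `S`. -/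
def IsESSE {R : Type*} [Semiring R] (S : Set R) {m n : ℕ}
    (A : Matrix (Fin m) (Fin m) R) (B : Matrix (Fin n) (Fin n) R) : Prop :=
  ∃ (U : Matrix (Fin m) (Fin n) R) (V : Matrix (Fin n) (Fin m) R),
    entriesIn S U ∧ entriesIn S V ∧ A = U * V ∧ B = V * U

/-- Strong shift equivalence over `S`: a chain of elementary strong shift equivalences. -/
def IsSSE {R : Type*} [Semiring R] (S : Set R) {m n : ℕ}
    (A : Matrix (Fin m) (Fin m) R) (B : Matrix (Fin n) (Fin n) R) : Prop :=
  Relation.TransGen (fun X Y : Σ k, Matrix (Fin k) (Fin k) R => IsESSE S X.2 Y.2) ⟨m, A⟩ ⟨n, B⟩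

/-- The entrywise sup norm of a real matrix. -/
noncomputable def matNormInf {m n : ℕ} (M : Matrix (Fin m) (Fin n) ℝ) : ℝ :=
  ⨆ i, ⨆ j, |M i j|

section SSEProof

open Matrix Polynomial


/-- Strong shift equivalence for matrices indexed by arbitrary finite types. -/
def GSSE (S : Subring ℝ) {I J : Type} (A : Matrix I I ℝ) (B : Matrix J J ℝ) : Prop :=
  ∀ (m k : ℕ) (f : Fin m ≃ I) (g : Fin k ≃ J),
    IsSSE (S : Set ℝ) (A.submatrix f f) (B.submatrix g g)

theorem GSSE.of_esse {S : Subring ℝ} {I J : Type} [Fintype I] [Fintype J]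
    {A : Matrix I I ℝ} {B : Matrix J J ℝ} (U : Matrix I J ℝ) (V : Matrix J I ℝ)
    (hU : ∀ i j, U i j ∈ S) (hV : ∀ i j, V i j ∈ S) (hA : A = U * V) (hB : B = V * U) :
    GSSE S A B := by
  intro m k f g
  refine Relation.TransGen.single ⟨U.submatrix f g, V.submatrix g f, ?_, ?_, ?_, ?_⟩
  · intro i j; exact hU _ _
  · intro i j; exact hV _ _
  · simp [hA, Matrix.submatrix_mul_equiv]
  · simp [hB, Matrix.submatrix_mul_equiv]

theorem IsSSE.symm' {S : Set ℝ} {m k : ℕ} {A : Matrix (Fin m) (Fin m) ℝ}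
    {B : Matrix (Fin k) (Fin k) ℝ} (h : IsSSE S A B) : IsSSE S B A := by
  unfold IsSSE at *
  have hs : Std.Symm (fun X Y : Σ k, Matrix (Fin k) (Fin k) ℝ => IsESSE S X.2 Y.2) := ⟨by
    rintro X Y ⟨U, V, hU, hV, h1, h2⟩
    exact ⟨V, U, hV, hU, h2, h1⟩⟩
  exact Relation.TransGen.stdSymm.symm _ _ h

theorem GSSE.symm {S : Subring ℝ} {I J : Type} {A : Matrix I I ℝ} {B : Matrix J J ℝ}
    (h : GSSE S A B) : GSSE S B A := fun m k f g => (h k m g f).symm'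

theorem GSSE.trans {S : Subring ℝ} {I J L : Type} [Fintype J] {A : Matrix I I ℝ}
    {B : Matrix J J ℝ} {C : Matrix L L ℝ}
    (h : GSSE S A B) (h' : GSSE S B C) : GSSE S A C := fun m k f g => by
  classical
  exact Relation.TransGen.trans (h m _ f (Fintype.equivFin J).symm)
    (h' _ k (Fintype.equivFin J).symm g)

theorem IsSSE.transpose' {S : Set ℝ} {m k : ℕ} {A : Matrix (Fin m) (Fin m) ℝ}
    {B : Matrix (Fin k) (Fin k) ℝ} (h : IsSSE S A B) : IsSSE S Aᵀ Bᵀ := by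
  unfold IsSSE at *
  refine Relation.TransGen.lift
    (f := fun X : Σ k, Matrix (Fin k) (Fin k) ℝ => (⟨X.1, X.2ᵀ⟩ : Σ k, Matrix (Fin k) (Fin k) ℝ))
    ?_ _ _ h
  rintro X Y ⟨U, V, hU, hV, h1, h2⟩
  exact ⟨Vᵀ, Uᵀ, fun i j => hV _ _, fun i j => hU _ _, by simp [h1], by simp [h2]⟩

theorem GSSE.transpose {S : Subring ℝ} {I J : Type} {A : Matrix I I ℝ} {B : Matrix J J ℝ}
    (h : GSSE S A B) : GSSE S Aᵀ Bᵀ := fun m k f g => (h m k f g).transpose'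

theorem GSSE.reindex {S : Subring ℝ} {I J : Type} [Fintype I] [Fintype J] [DecidableEq I]
    {A : Matrix I I ℝ} (hA : ∀ i j, A i j ∈ S) (f : J ≃ I) :
    GSSE S (A.submatrix f f) A := by
  refine GSSE.of_esse ((1 : Matrix I I ℝ).submatrix f id) (A.submatrix id f) ?_ ?_ ?_ ?_
  · intro i j
    simp only [Matrix.submatrix_apply, Matrix.one_apply]
    split_ifs
    · exact S.one_mem
    · exact S.zero_mem
  · intro i j; exact hA _ _
  · ext i j; simp [Matrix.mul_apply, Matrix.one_apply]
  · ext i j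
    have := Equiv.sum_comp f (fun x => A i x * (1 : Matrix I I ℝ) x j)
    simp only [Matrix.mul_apply, Matrix.submatrix_apply]
    refine Eq.trans ?_ this.symm
    simp [Matrix.one_apply]

theorem GSSE.refl {S : Subring ℝ} {I : Type} [Fintype I] [DecidableEq I]
    {A : Matrix I I ℝ} (hA : ∀ i j, A i j ∈ S) : GSSE S A A :=
  GSSE.reindex hA (Equiv.refl I)

theorem mem_fromBlocks {S : Subring ℝ} {I J K L : Type} {A : Matrix I J ℝ} {B : Matrix I K ℝ}
    {C : Matrix L J ℝ} {D : Matrix L K ℝ} (hA : ∀ i j, A i j ∈ S) (hB : ∀ i j, B i j ∈ S)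
    (hC : ∀ i j, C i j ∈ S) (hD : ∀ i j, D i j ∈ S) : ∀ i j, fromBlocks A B C D i j ∈ S := by
  rintro (i | i) (j | j)
  · exact hA _ _
  · exact hB _ _
  · exact hC _ _
  · exact hD _ _

theorem mem_mul {S : Subring ℝ} {I J K : Type} [Fintype J] {A : Matrix I J ℝ} {B : Matrix J K ℝ}
    (hA : ∀ i j, A i j ∈ S) (hB : ∀ i j, B i j ∈ S) : ∀ i j, (A * B) i j ∈ S := by
  intro i j
  rw [Matrix.mul_apply]
  exact S.sum_mem fun k _ => S.mul_mem (hA _ _) (hB _ _)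

theorem mem_one {S : Subring ℝ} {I : Type} [DecidableEq I] :
    ∀ i j, (1 : Matrix I I ℝ) i j ∈ S := by
  intro i j
  simp only [Matrix.one_apply]
  split_ifs
  · exact S.one_mem
  · exact S.zero_mem

theorem mem_zero' {S : Subring ℝ} {I J : Type} :
    ∀ i j, (0 : Matrix I J ℝ) i j ∈ S := fun _ _ => S.zero_mem

theorem mem_fromRows {S : Subring ℝ} {I J K : Type} {A : Matrix I J ℝ} {B : Matrix K J ℝ}
    (hA : ∀ i j, A i j ∈ S) (hB : ∀ i j, B i j ∈ S) : ∀ i j, fromRows A B i j ∈ S := by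
  rintro (i | i) j
  · exact hA _ _
  · exact hB _ _

theorem mem_fromCols {S : Subring ℝ} {I J K : Type} {A : Matrix J I ℝ} {B : Matrix J K ℝ}
    (hA : ∀ i j, A i j ∈ S) (hB : ∀ i j, B i j ∈ S) : ∀ i j, fromCols A B i j ∈ S := by
  rintro i (j | j)
  · exact hA _ _
  · exact hB _ _

/-- Removing a strictly triangular sink block. -/
theorem GSSE.tri {S : Subring ℝ} {I Z : Type} [Fintype I] [Fintype Z] [DecidableEq I]
    [DecidableEq Z] {A : Matrix I I ℝ} {X : Matrix I Z ℝ} {E : Matrix Z Z ℝ}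
    (hA : ∀ i j, A i j ∈ S) (hX : ∀ i j, X i j ∈ S) (hE : ∀ i j, E i j ∈ S)
    (h : Z → ℕ) (hh : ∀ i j, E i j ≠ 0 → h j < h i) :
    GSSE S (fromBlocks A X 0 E) A := by
  let d : ℕ → (I ⊕ Z) → ℝ := fun k => Sum.elim (fun _ => 1) (fun z => if k ≤ h z then 1 else 0)
  have hd : ∀ k i j, diagonal (d k) i j ∈ S := by
    intro k i j
    simp only [Matrix.diagonal_apply]
    split_ifs
    · rcases i with i | i
      · exact S.one_mem
      · simp only [d, Sum.elim_inr]
        split_ifs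
        · exact S.one_mem
        · exact S.zero_mem
    · exact S.zero_mem
  have hM := mem_fromBlocks hA hX (mem_zero' (S := S)) hE
  have key : ∀ k, GSSE S (fromBlocks A X 0 E) (fromBlocks A X 0 E * diagonal (d k)) := by
    intro k
    induction k with
    | zero =>
      have : diagonal (d 0) = 1 := by
        rw [← Matrix.diagonal_one]; congr 1; ext (i | i) <;> simp [d]
      rw [this, mul_one]
      exact GSSE.refl hM
    | succ k ih =>
      refine ih.trans ?_
      refine GSSE.of_esse (diagonal (d (k+1))) (fromBlocks A X 0 E * diagonal (d k)) (hd _)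
        (mem_mul hM (hd _)) ?_ ?_
      · ext (i | i) (j | j)
        · simp [d]
        · simp [d]
        · simp [d]
        · simp only [mul_diagonal, diagonal_mul, fromBlocks_apply₂₂, d, Sum.elim_inr]
          by_cases hij : E i j = 0
          · simp [hij]
          · have := hh _ _ hij
            by_cases h1 : k ≤ h j
            · rw [if_pos h1, if_pos (by omega)]; simp
            · simp [h1]
      · rw [Matrix.mul_assoc, Matrix.diagonal_mul_diagonal]
        congr 2
        ext (i | i)
        · simp [d]
        · simp only [d, Sum.elim_inr]
          by_cases h1 : k + 1 ≤ h i
          · simp [h1, (show k ≤ h i by omega)]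
          · simp [h1]
  obtain ⟨H, hH⟩ : ∃ H, ∀ z, h z < H :=
    ⟨Finset.univ.sup h + 1, fun z => Nat.lt_succ_of_le (Finset.le_sup (Finset.mem_univ z))⟩
  refine (key H).trans ?_
  refine GSSE.of_esse (fromRows A 0) (fromCols 1 0) (mem_fromRows hA mem_zero')
    (mem_fromCols mem_one mem_zero') ?_ ?_
  · rw [fromRows_mul_fromCols]
    ext (i | i) (j | j) <;> simp [d, hH]
  · rw [fromCols_mul_fromRows]; simp

theorem GSSE.trilow {S : Subring ℝ} {I Z : Type} [Fintype I] [Fintype Z] [DecidableEq I]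
    [DecidableEq Z] {A : Matrix I I ℝ} {X : Matrix Z I ℝ} {E : Matrix Z Z ℝ}
    (hA : ∀ i j, A i j ∈ S) (hX : ∀ i j, X i j ∈ S) (hE : ∀ i j, E i j ∈ S)
    (h : Z → ℕ) (hh : ∀ i j, E i j ≠ 0 → h j < h i) :
    GSSE S (fromBlocks A 0 X E) A := by
  obtain ⟨H, hH⟩ : ∃ H, ∀ z, h z < H :=
    ⟨Finset.univ.sup h + 1, fun z => Nat.lt_succ_of_le (Finset.le_sup (Finset.mem_univ z))⟩
  have := (GSSE.tri (S := S) (A := Aᵀ) (X := Xᵀ) (E := Eᵀ) (fun i j => hA _ _) (fun i j => hX _ _)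
    (fun i j => hE _ _) (fun z => H - h z) (fun i j hij => by
      have h1 := hh _ _ hij
      have := hH i; have := hH j; omega)).transpose
  simpa [fromBlocks_transpose] using this

theorem GSSE.zigzag {S : Subring ℝ} {I Z Y : Type} [Fintype I] [Fintype Z] [DecidableEq I]
    [DecidableEq Z] [Fintype Y] [DecidableEq Y]
    {a : Matrix I I ℝ} {b : Matrix I Z ℝ} {e : Matrix Z Z ℝ} {c : Matrix Y I ℝ}
    {e' : Matrix Y Y ℝ} {T : Matrix Z Y ℝ}
    (ha : ∀ i j, a i j ∈ S) (hb : ∀ i j, b i j ∈ S) (he : ∀ i j, e i j ∈ S)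
    (hc : ∀ i j, c i j ∈ S) (he' : ∀ i j, e' i j ∈ S) (hT : ∀ i j, T i j ∈ S)
    (h : Z → ℕ) (hh : ∀ i j, e i j ≠ 0 → h j < h i)
    (h' : Y → ℕ) (hh' : ∀ i j, e' i j ≠ 0 → h' j < h' i) (hcomm : e * T = T * e') :
    GSSE S (fromBlocks a b (T * c) e) (fromBlocks a (b * T) c e') := by
  have h1 := GSSE.trilow (S := S) (A := fromBlocks a b (T * c) e) (X := fromCols c 0) (E := e')
    (mem_fromBlocks ha hb (mem_mul hT hc) he) (mem_fromCols hc mem_zero') he' h' hh'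
  have h2 := GSSE.tri (S := S) (A := fromBlocks a (b * T) c e') (X := fromRows b 0) (E := e)
    (mem_fromBlocks ha (mem_mul hb hT) hc he') (mem_fromRows hb mem_zero') he h hh
  refine h1.symm.trans (GSSE.trans ?_ h2)
  let G : Matrix ((I ⊕ Z) ⊕ Y) ((I ⊕ Y) ⊕ Z) ℝ :=
    fromBlocks (fromBlocks 1 0 0 T) (fromRows 0 1) (fromCols 0 1) 0
  let G' : Matrix ((I ⊕ Y) ⊕ Z) ((I ⊕ Z) ⊕ Y) ℝ :=
    fromBlocks (fromBlocks a b c 0) (fromRows 0 e') (fromCols 0 e) (-(e * T))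
  have hG : ∀ i j, G i j ∈ S := mem_fromBlocks (mem_fromBlocks mem_one mem_zero' mem_zero' hT)
    (mem_fromRows mem_zero' mem_one) (mem_fromCols mem_zero' mem_one) mem_zero'
  have hG' : ∀ i j, G' i j ∈ S := mem_fromBlocks
    (mem_fromBlocks ha hb hc mem_zero')
    (mem_fromRows mem_zero' he') (mem_fromCols mem_zero' he)
    (fun i j => S.neg_mem (mem_mul he hT i j))
  have hcomm' : ∀ i j, ∑ x, e i x * T x j = ∑ x, T i x * e' x j := by
    intro i j
    have := congrFun (congrFun hcomm i) j
    simpa [Matrix.mul_apply] using this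
  refine GSSE.of_esse G G' hG hG' ?_ ?_
  · ext ((i | i) | i) ((j | j) | j) <;>
      simp [G, G', Matrix.mul_apply, Fintype.sum_sum_type, Matrix.one_apply, hcomm']
  · ext ((i | i) | i) ((j | j) | j) <;>
      simp [G, G', Matrix.mul_apply, Fintype.sum_sum_type, Matrix.one_apply]

/-- `fromBlocks a b c e` is a linearization of the polynomial matrix `A`. -/
structure Lin (S : Subring ℝ) {n : ℕ} {I : Type} [Fintype I]
    (a : Matrix (Fin n) (Fin n) ℝ) (b : Matrix (Fin n) I ℝ) (c : Matrix I (Fin n) ℝ)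
    (e : Matrix I I ℝ) (A : Matrix (Fin n) (Fin n) ℝ[X]) (W : Matrix I (Fin n) ℝ[X])
    (h : I → ℕ) : Prop where
  ha : ∀ i j, a i j ∈ S
  hb : ∀ i j, b i j ∈ S
  hc : ∀ i j, c i j ∈ S
  he : ∀ i j, e i j ∈ S
  hh : ∀ i j, e i j ≠ 0 → h j < h i
  hW : W = (X : ℝ[X]) • (c.map C + e.map C * W)
  hA : A = (X : ℝ[X]) • (a.map C + b.map C * W)

theorem Lin.W_zero {S : Subring ℝ} {n : ℕ} {I : Type} [Fintype I]
    {a : Matrix (Fin n) (Fin n) ℝ} {b : Matrix (Fin n) I ℝ} {c : Matrix I (Fin n) ℝ}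
    {e : Matrix I I ℝ} {A : Matrix (Fin n) (Fin n) ℝ[X]} {W : Matrix I (Fin n) ℝ[X]}
    {h : I → ℕ} (H : Lin S a b c e A W h) (i : I) (l : Fin n) : (W i l).coeff 0 = 0 := by
  rw [H.hW]; simp

theorem Lin.W_succ {S : Subring ℝ} {n : ℕ} {I : Type} [Fintype I]
    {a : Matrix (Fin n) (Fin n) ℝ} {b : Matrix (Fin n) I ℝ} {c : Matrix I (Fin n) ℝ}
    {e : Matrix I I ℝ} {A : Matrix (Fin n) (Fin n) ℝ[X]} {W : Matrix I (Fin n) ℝ[X]}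
    {h : I → ℕ} (H : Lin S a b c e A W h) (i : I) (l : Fin n) (j : ℕ) :
    (W i l).coeff (j + 1) = (if j = 0 then c i l else 0) + ∑ x, e i x * (W x l).coeff j := by
  conv_lhs => rw [H.hW]
  simp [Matrix.mul_apply, coeff_X_mul, coeff_C, finsetSum_coeff]

theorem Lin.A_zero {S : Subring ℝ} {n : ℕ} {I : Type} [Fintype I]
    {a : Matrix (Fin n) (Fin n) ℝ} {b : Matrix (Fin n) I ℝ} {c : Matrix I (Fin n) ℝ}
    {e : Matrix I I ℝ} {A : Matrix (Fin n) (Fin n) ℝ[X]} {W : Matrix I (Fin n) ℝ[X]}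
    {h : I → ℕ} (H : Lin S a b c e A W h) (i : Fin n) (l : Fin n) : (A i l).coeff 0 = 0 := by
  rw [H.hA]; simp

theorem Lin.A_succ {S : Subring ℝ} {n : ℕ} {I : Type} [Fintype I]
    {a : Matrix (Fin n) (Fin n) ℝ} {b : Matrix (Fin n) I ℝ} {c : Matrix I (Fin n) ℝ}
    {e : Matrix I I ℝ} {A : Matrix (Fin n) (Fin n) ℝ[X]} {W : Matrix I (Fin n) ℝ[X]}
    {h : I → ℕ} (H : Lin S a b c e A W h) (i : Fin n) (l : Fin n) (j : ℕ) :
    (A i l).coeff (j + 1) = (if j = 0 then a i l else 0) + ∑ x, b i x * (W x l).coeff j := by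
  conv_lhs => rw [H.hA]
  simp [Matrix.mul_apply, coeff_X_mul, coeff_C, finsetSum_coeff]

theorem Lin.W_mem {S : Subring ℝ} {n : ℕ} {I : Type} [Fintype I]
    {a : Matrix (Fin n) (Fin n) ℝ} {b : Matrix (Fin n) I ℝ} {c : Matrix I (Fin n) ℝ}
    {e : Matrix I I ℝ} {A : Matrix (Fin n) (Fin n) ℝ[X]} {W : Matrix I (Fin n) ℝ[X]}
    {h : I → ℕ} (H : Lin S a b c e A W h) (j : ℕ) : ∀ i l, (W i l).coeff j ∈ S := by
  induction j with
  | zero => intro i l; rw [H.W_zero]; exact S.zero_mem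
  | succ j ih =>
    intro i l
    rw [H.W_succ]
    refine S.add_mem ?_ (S.sum_mem fun x _ => S.mul_mem (H.he _ _) (ih _ _))
    split_ifs
    · exact H.hc _ _
    · exact S.zero_mem

theorem Lin.A_mem {S : Subring ℝ} {n : ℕ} {I : Type} [Fintype I]
    {a : Matrix (Fin n) (Fin n) ℝ} {b : Matrix (Fin n) I ℝ} {c : Matrix I (Fin n) ℝ}
    {e : Matrix I I ℝ} {A : Matrix (Fin n) (Fin n) ℝ[X]} {W : Matrix I (Fin n) ℝ[X]}
    {h : I → ℕ} (H : Lin S a b c e A W h) (j : ℕ) : ∀ i l, (A i l).coeff j ∈ S := by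
  intro i l
  cases j with
  | zero => rw [H.A_zero]; exact S.zero_mem
  | succ j =>
    rw [H.A_succ]
    refine S.add_mem ?_ (S.sum_mem fun x _ => S.mul_mem (H.hb _ _) (H.W_mem _ _ _))
    split_ifs
    · exact H.ha _ _
    · exact S.zero_mem

/-- The canonical block companion linearization is strong shift equivalent to any other. -/
theorem Lin.companion {S : Subring ℝ} {n : ℕ} {I : Type} [Fintype I] [DecidableEq I]
    {a : Matrix (Fin n) (Fin n) ℝ} {b : Matrix (Fin n) I ℝ} {c : Matrix I (Fin n) ℝ}
    {e : Matrix I I ℝ} {A : Matrix (Fin n) (Fin n) ℝ[X]} {W : Matrix I (Fin n) ℝ[X]}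
    {h : I → ℕ} (H : Lin S a b c e A W h) (D : ℕ) (hD0 : 0 < D)
    (hD : ∀ i l, (W i l).natDegree ≤ D) :
    GSSE S (fromBlocks a b c e)
      (fromBlocks (of fun i l => (A i l).coeff 1)
        (of fun i (y : Fin D × Fin n) => (A i y.2).coeff ((y.1 : ℕ) + 2))
        (of fun (y : Fin D × Fin n) l => if (y.1 : ℕ) = 0 ∧ y.2 = l then (1 : ℝ) else 0)
        (of fun (y z : Fin D × Fin n) =>
          if (z.1 : ℕ) + 1 = y.1 ∧ y.2 = z.2 then (1 : ℝ) else 0)) := by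
  let T : Matrix I (Fin D × Fin n) ℝ := of fun i y => (W i y.2).coeff ((y.1 : ℕ) + 1)
  let c' : Matrix (Fin D × Fin n) (Fin n) ℝ :=
    of fun (y : Fin D × Fin n) l => if (y.1 : ℕ) = 0 ∧ y.2 = l then (1 : ℝ) else 0
  let e' : Matrix (Fin D × Fin n) (Fin D × Fin n) ℝ :=
    of fun (y z : Fin D × Fin n) => if (z.1 : ℕ) + 1 = y.1 ∧ y.2 = z.2 then (1 : ℝ) else 0
  have hT : ∀ i j, T i j ∈ S := fun i j => H.W_mem _ _ _
  have hc' : ∀ i j, c' i j ∈ S := by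
    intro i j
    simp only [c', of_apply]
    split_ifs
    · exact S.one_mem
    · exact S.zero_mem
  have he' : ∀ i j, e' i j ∈ S := by
    intro i j
    simp only [e', of_apply]
    split_ifs
    · exact S.one_mem
    · exact S.zero_mem
  have hcomm : e * T = T * e' := by
    ext i ⟨j, l⟩
    have h1 : (e * T) i (j, l) = (W i l).coeff ((j : ℕ) + 1 + 1) := by
      rw [H.W_succ]
      simp [T, Matrix.mul_apply]
    rw [h1]
    simp only [Matrix.mul_apply, Fintype.sum_prod_type, T, e', of_apply]
    by_cases hj : (j : ℕ) + 1 < D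
    · rw [Finset.sum_eq_single (⟨j + 1, hj⟩ : Fin D)]
      · simp
      · intro x _ hx
        have : (j : ℕ) + 1 ≠ x := fun h => hx (Fin.ext h.symm)
        simp [this]
      · simp
    · rw [Finset.sum_eq_zero]
      · exact coeff_eq_zero_of_natDegree_lt (by have := hD i l; omega)
      · intro x _
        have : (j : ℕ) + 1 ≠ x := by have := x.2; omega
        simp [this]
  have hTc : T * c' = c := by
    ext i l
    simp only [Matrix.mul_apply, Fintype.sum_prod_type, T, c', of_apply]
    rw [Finset.sum_eq_single (⟨0, hD0⟩ : Fin D)]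
    · simp [H.W_succ, H.W_zero]
    · intro x _ hx
      have : (x : ℕ) ≠ 0 := fun h => hx (Fin.ext h)
      simp [this]
    · simp
  have hbT : b * T = of fun i (y : Fin D × Fin n) => (A i y.2).coeff ((y.1 : ℕ) + 2) := by
    ext i ⟨j, l⟩
    simp [H.A_succ, Matrix.mul_apply, T]
  have ha : (of fun i l => (A i l).coeff 1) = a := by
    ext i l
    simp [H.A_succ, H.W_zero]
  have := GSSE.zigzag (S := S) (a := a) (b := b) (e := e) (c := c') (e' := e') (T := T)
    H.ha H.hb H.he hc' he' hT h H.hh (fun y => (y.1 : ℕ)) (by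
      intro i j hij
      simp only [e', of_apply] at hij
      have : (j.1 : ℕ) + 1 = i.1 ∧ i.2 = j.2 := by
        by_contra h0
        exact hij (if_neg h0)
      show (j.1 : ℕ) < i.1
      omega) hcomm
  rw [hTc, hbT] at this
  rw [ha]
  exact this

theorem Lin.unique {S : Subring ℝ} {n : ℕ} {I : Type} [Fintype I] [DecidableEq I]
    {a : Matrix (Fin n) (Fin n) ℝ} {b : Matrix (Fin n) I ℝ} {c : Matrix I (Fin n) ℝ}
    {e : Matrix I I ℝ} {A : Matrix (Fin n) (Fin n) ℝ[X]} {W : Matrix I (Fin n) ℝ[X]}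
    {h : I → ℕ} {I' : Type} [Fintype I'] [DecidableEq I']
    {a' : Matrix (Fin n) (Fin n) ℝ} {b' : Matrix (Fin n) I' ℝ} {c' : Matrix I' (Fin n) ℝ}
    {e' : Matrix I' I' ℝ} {W' : Matrix I' (Fin n) ℝ[X]}
    {h' : I' → ℕ} (H : Lin S a b c e A W h) (H' : Lin S a' b' c' e' A W' h') :
    GSSE S (fromBlocks a b c e) (fromBlocks a' b' c' e') := by
  obtain ⟨D1, hD1⟩ : ∃ D, ∀ p : I × Fin n, (W p.1 p.2).natDegree ≤ D :=
    ⟨Finset.univ.sup fun p : I × Fin n => (W p.1 p.2).natDegree, fun p =>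
      Finset.le_sup (f := fun p : I × Fin n => (W p.1 p.2).natDegree) (Finset.mem_univ p)⟩
  obtain ⟨D2, hD2⟩ : ∃ D, ∀ p : I' × Fin n, (W' p.1 p.2).natDegree ≤ D :=
    ⟨Finset.univ.sup fun p : I' × Fin n => (W' p.1 p.2).natDegree, fun p =>
      Finset.le_sup (f := fun p : I' × Fin n => (W' p.1 p.2).natDegree) (Finset.mem_univ p)⟩
  exact (H.companion (D1 + D2 + 1) (by omega) (fun i l => by
    have := hD1 (i, l); simp at this; omega)).trans
    (H'.companion (D1 + D2 + 1) (by omega)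
      (fun i l => by have := hD2 (i, l); simp at this; omega)).symm

/-- The elementary operation `1 - A ↦ (1 + x t^k u vᵀ) (1 - A)`. -/
theorem Lin.op {S : Subring ℝ} {n : ℕ} {I : Type} [Fintype I] [DecidableEq I]
    {a : Matrix (Fin n) (Fin n) ℝ} {b : Matrix (Fin n) I ℝ} {c : Matrix I (Fin n) ℝ}
    {e : Matrix I I ℝ} {A : Matrix (Fin n) (Fin n) ℝ[X]} {W : Matrix I (Fin n) ℝ[X]}
    {h : I → ℕ} (H : Lin S a b c e A W h) (k : ℕ) (hk : 0 < k) (x : ℝ) (hx : x ∈ S)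
    (u v : Fin n → ℝ) (hu : ∀ i, u i ∈ S) (hv : ∀ i, v i ∈ S) (huv : ∑ i, v i * u i = 0) :
    ∃ (a' : Matrix (Fin n) (Fin n) ℝ) (b' : Matrix (Fin n) (I ⊕ Fin k) ℝ)
      (c' : Matrix (I ⊕ Fin k) (Fin n) ℝ) (e' : Matrix (I ⊕ Fin k) (I ⊕ Fin k) ℝ)
      (W' : Matrix (I ⊕ Fin k) (Fin n) ℝ[X]) (h' : I ⊕ Fin k → ℕ),
      Lin S a' b' c' e' (A + (C x * X ^ k) • ((vecMulVec u v).map C * (A - 1))) W' h' ∧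
      GSSE S (fromBlocks a' b' c' e') (fromBlocks a b c e) := by
  let U : Matrix (Fin n) (Fin k) ℝ := of fun i y => if (y : ℕ) + 1 = k then x * u i else 0
  let Q : Matrix (Fin k) (Fin n) ℝ := of fun y i => if (y : ℕ) = 0 then v i else 0
  let E : Matrix (Fin k) (Fin k) ℝ := of fun y z => if (z : ℕ) + 1 = y then 1 else 0
  have hU : ∀ i j, U i j ∈ S := by
    intro i j
    simp only [U, of_apply]
    split_ifs
    · exact S.mul_mem hx (hu _)
    · exact S.zero_mem
  have hQ : ∀ i j, Q i j ∈ S := by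
    intro i j
    simp only [Q, of_apply]
    split_ifs
    · exact hv _
    · exact S.zero_mem
  have hE : ∀ i j, E i j ∈ S := by
    intro i j
    simp only [E, of_apply]
    split_ifs
    · exact S.one_mem
    · exact S.zero_mem
  have hEh : ∀ i j, E i j ≠ 0 → (j : ℕ) < i := by
    intro i j hij
    simp only [E, of_apply] at hij
    have : (j : ℕ) + 1 = i := by
      by_contra h0
      exact hij (if_neg h0)
    omega
  have hQU : Q * U = 0 := by
    ext y z
    simp only [Matrix.mul_apply, Q, U, of_apply, Matrix.zero_apply]
    by_cases h1 : (y : ℕ) = 0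
    · by_cases h2 : (z : ℕ) + 1 = k
      · simp only [h1, h2, if_true]
        calc ∑ i, v i * (x * u i) = x * ∑ i, v i * u i := by
              rw [Finset.mul_sum]; exact Finset.sum_congr rfl fun _ _ => by ring
          _ = 0 := by rw [huv, mul_zero]
      · simp [h2]
    · simp [h1]
  obtain ⟨B, hB⟩ : ∃ B, ∀ z, h z < B :=
    ⟨Finset.univ.sup h + 1, fun z => Nat.lt_succ_of_le (Finset.le_sup (Finset.mem_univ z))⟩
  let g : Fin n → ℝ[X] := fun l => ∑ i, C (v i) * (A - 1) i l
  let G : Matrix (Fin k) (Fin n) ℝ[X] := of fun y l => X ^ (y : ℕ) * g l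
  have hEG : (X : ℝ[X]) • (E.map C * G) = G - Q.map C * (A - 1) := by
    ext1 y l
    simp only [Matrix.smul_apply, Matrix.mul_apply, Matrix.sub_apply (A := G), Matrix.map_apply,
      E, G, Q, of_apply, smul_eq_mul]
    by_cases hy : (y : ℕ) = 0
    · simp [hy, g]
    · rw [Finset.sum_eq_single (⟨(y : ℕ) - 1, by omega⟩ : Fin k)]
      · have h1 : (y : ℕ) - 1 + 1 = y := by omega
        simp only [h1, hy, if_true, if_false, map_one, map_zero, zero_mul, Finset.sum_const_zero,
          sub_zero, one_mul]
        rw [← mul_assoc, ← pow_succ', h1]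
      · intro z _ hz
        have : (z : ℕ) + 1 ≠ y := fun h0 => hz (Fin.ext (by simp; omega))
        simp [this]
      · simp
  have hUG : (X : ℝ[X]) • (U.map C * G) =
      (C x * X ^ k) • ((vecMulVec u v).map C * (A - 1)) := by
    ext1 i l
    simp only [Matrix.smul_apply, Matrix.mul_apply, Matrix.map_apply,
      U, G, of_apply, smul_eq_mul, vecMulVec_apply]
    rw [Finset.sum_eq_single (⟨k - 1, by omega⟩ : Fin k)]
    · have h1 : k - 1 + 1 = k := by omega
      simp only [h1, if_true, g, map_mul, Finset.mul_sum]
      refine Finset.sum_congr rfl fun j _ => ?_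
      conv_rhs => rw [← h1, pow_succ]
      ring
    · intro z _ hz
      have : (z : ℕ) + 1 ≠ k := fun h0 => hz (Fin.ext (by simp; omega))
      simp [this]
    · simp
  have hQA : Q.map C * A = (X : ℝ[X]) • ((Q * a).map C + (Q * b).map C * W) := by
    conv_lhs => rw [H.hA]
    rw [Matrix.map_mul, Matrix.map_mul, Matrix.mul_smul, Matrix.mul_add, Matrix.mul_assoc]
  have mapsub : ∀ (p q : Matrix (Fin k) (Fin n) ℝ), (p - q).map C = p.map C - q.map C :=
    fun p q => by ext1 i j; simp
  refine ⟨a - U * Q, fromCols b U, fromRows c (Q * a - E * Q), fromBlocks e 0 (Q * b) E,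
    fromRows W (G + Q.map C), Sum.elim h (fun y => B + y), ⟨?_, ?_, ?_, ?_, ?_, ?_, ?_⟩, ?_⟩
  · exact fun i j => S.sub_mem (H.ha _ _) (mem_mul hU hQ _ _)
  · exact mem_fromCols H.hb hU
  · exact mem_fromRows H.hc fun i j => S.sub_mem (mem_mul hQ H.ha _ _) (mem_mul hE hQ _ _)
  · exact mem_fromBlocks H.he mem_zero' (mem_mul hQ H.hb) hE
  · rintro (i | i) (j | j) hij
    · exact H.hh _ _ hij
    · exact absurd rfl hij
    · have := hB j
      simp only [Sum.elim_inl, Sum.elim_inr]; omega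
    · have := hEh _ _ hij
      simp only [Sum.elim_inr]; omega
  · have e1 : (fromBlocks e 0 (Q * b) E).map C * fromRows W (G + Q.map C) =
        fromRows (e.map C * W) ((Q * b).map C * W + E.map C * (G + Q.map C)) := by
      rw [fromBlocks_map, fromBlocks_mul_fromRows]; simp
    have e2 : (fromRows c (Q * a - E * Q)).map C =
        fromRows (c.map C) ((Q * a).map C - E.map C * Q.map C) := by
      rw [← Matrix.map_mul, ← mapsub]
      ext1 (i | i) j <;> rfl
    rw [e1, e2]
    have e3 : G + Q.map C = (X : ℝ[X]) • ((Q * a).map C - E.map C * Q.map C +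
        ((Q * b).map C * W + E.map C * (G + Q.map C))) := by
      have : (Q * a).map C - E.map C * Q.map C +
        ((Q * b).map C * W + E.map C * (G + Q.map C)) =
        ((Q * a).map C + (Q * b).map C * W) + E.map C * G := by
        rw [Matrix.mul_add]; abel
      rw [this, smul_add, ← hQA, hEG, Matrix.mul_sub, Matrix.mul_one]; abel
    ext1 (i | i) l
    · simpa using congrFun (congrFun H.hW i) l
    · simpa using congrFun (congrFun e3 i) l
  · have e1 : (fromCols b U).map C * fromRows W (G + Q.map C) =
        b.map C * W + U.map C * (G + Q.map C) := by
      rw [← fromCols_mul_fromRows]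
      congr 1
      ext1 i (j | j) <;> rfl
    have e2 : (a - U * Q).map C = a.map C - U.map C * Q.map C := by
      rw [← Matrix.map_mul]; ext1 i j; simp [-Matrix.map_mul]
    rw [e1, e2, ← hUG]
    conv_lhs => rw [H.hA]
    rw [← smul_add]
    congr 1
    rw [Matrix.mul_add]; abel
  · have h1 := GSSE.tri (S := S) (A := fromBlocks a b c e) (X := fromRows U 0) (E := E)
      (mem_fromBlocks H.ha H.hb H.hc H.he) (mem_fromRows hU mem_zero') hE (fun y => (y : ℕ)) hEh
    refine GSSE.trans ?_ h1
    let P : Matrix (Fin n ⊕ (I ⊕ Fin k)) ((Fin n ⊕ I) ⊕ Fin k) ℝ :=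
      fromBlocks (fromCols 1 0) 0 (fromBlocks 0 1 Q 0) (fromRows 0 1)
    let V : Matrix ((Fin n ⊕ I) ⊕ Fin k) (Fin n ⊕ (I ⊕ Fin k)) ℝ :=
      fromBlocks (fromRows (a - U * Q) c) (fromBlocks b U e 0) (- (E * Q)) (fromCols 0 E)
    have hQU' : ∀ i j, ∑ x, Q i x * U x j = 0 := by
      intro i j
      have := congrFun (congrFun hQU i) j
      simpa [Matrix.mul_apply] using this
    have hQUQ : ∀ i j, ∑ x, Q i x * ∑ y, U x y * Q y j = 0 := by
      intro i j
      have : (Q * (U * Q)) i j = 0 := by rw [← Matrix.mul_assoc, hQU]; simp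
      simpa [Matrix.mul_apply] using this
    refine GSSE.of_esse P V ?_ ?_ ?_ ?_
    · exact mem_fromBlocks (mem_fromCols mem_one mem_zero') mem_zero'
        (mem_fromBlocks mem_zero' mem_one hQ mem_zero') (mem_fromRows mem_zero' mem_one)
    · exact mem_fromBlocks (mem_fromRows (fun i j => S.sub_mem (H.ha _ _) (mem_mul hU hQ _ _)) H.hc)
        (mem_fromBlocks H.hb hU H.he mem_zero') (fun i j => S.neg_mem (mem_mul hE hQ i j))
        (mem_fromCols mem_zero' hE)
    · clear_value U Q E
      ext (i | i | i) (j | j | j) <;>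
        simp [P, V, Matrix.mul_apply, Fintype.sum_sum_type, Matrix.one_apply, hQU', mul_add,
          hQUQ, sub_eq_add_neg, Finset.sum_add_distrib]
    · clear_value U Q E
      ext ((i | i) | i) ((j | j) | j) <;>
        simp [P, V, Matrix.mul_apply, Fintype.sum_sum_type, Matrix.one_apply]

/-- `A` has a linearization which is strong shift equivalent to `N`. -/
def SRep (S : Subring ℝ) {n : ℕ} (N : Matrix (Fin n) (Fin n) ℝ)
    (A : Matrix (Fin n) (Fin n) ℝ[X]) : Prop :=
  ∃ (I : Type) (_ : Fintype I) (_ : DecidableEq I) (a : Matrix (Fin n) (Fin n) ℝ)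
    (b : Matrix (Fin n) I ℝ) (c : Matrix I (Fin n) ℝ) (e : Matrix I I ℝ)
    (W : Matrix I (Fin n) ℝ[X]) (h : I → ℕ),
    Lin S a b c e A W h ∧ GSSE S (fromBlocks a b c e) N

theorem SRep.coeff_mem {S : Subring ℝ} {n : ℕ} {N : Matrix (Fin n) (Fin n) ℝ}
    {A : Matrix (Fin n) (Fin n) ℝ[X]} (H : SRep S N A) (m : ℕ) (i j : Fin n) :
    (A i j).coeff m ∈ S := by
  obtain ⟨I, _, _, a, b, c, e, W, h, hl, -⟩ := H
  exact hl.A_mem m i j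

theorem SRep.op {S : Subring ℝ} {n : ℕ} {N : Matrix (Fin n) (Fin n) ℝ}
    {A : Matrix (Fin n) (Fin n) ℝ[X]} (H : SRep S N A) (k : ℕ) (hk : 0 < k) (x : ℝ) (hx : x ∈ S)
    (u v : Fin n → ℝ) (hu : ∀ i, u i ∈ S) (hv : ∀ i, v i ∈ S) (huv : ∑ i, v i * u i = 0) :
    SRep S N (A + (C x * X ^ k) • ((vecMulVec u v).map C * (A - 1))) := by
  obtain ⟨I, _, _, a, b, c, e, W, h, hl, hs⟩ := H
  obtain ⟨a', b', c', e', W', h', hl', hs'⟩ := hl.op k hk x hx u v hu hv huv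
  exact ⟨_, inferInstance, inferInstance, a', b', c', e', W', h', hl', hs'.trans hs⟩

/-- The reduction has reached degree `k`, with the degree `k` coefficient satisfying `cond`. -/
def Stage (S : Subring ℝ) (n k : ℕ) (cond : Matrix (Fin n) (Fin n) ℝ → Prop) : Prop :=
  ∃ D : ℕ, ∀ η : ℝ, 0 < η → ∃ δ : ℝ, 0 < δ ∧ ∀ N : Matrix (Fin n) (Fin n) ℝ,
    (∀ i j, N i j ∈ S) → IsNilpotent N → (∀ i j, |N i j| < δ) →
    ∃ A : Matrix (Fin n) (Fin n) ℝ[X], SRep S N A ∧ det (1 - A) = 1 ∧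
      (∀ m, m < k → ∀ i j, (A i j).coeff m = 0) ∧
      (∀ m, D < m → ∀ i j, (A i j).coeff m = 0) ∧
      (∀ m i j, |(A i j).coeff m| < η) ∧ cond (of fun i j => (A i j).coeff k)

theorem stage_one (S : Subring ℝ) (n : ℕ) : Stage S n 1 (fun _ => True) := by
  refine ⟨1, fun η hη => ⟨η, hη, fun N hN hnil hsm => ?_⟩⟩
  have hco : ∀ m i j, (((X : ℝ[X]) • N.map C) i j).coeff m = if m = 1 then N i j else 0 := by
    intro m i j
    rcases m with _ | m
    · simp
    · simp [coeff_C]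
  refine ⟨(X : ℝ[X]) • N.map C, ?_, ?_, ?_, ?_, ?_, trivial⟩
  · refine ⟨Empty, inferInstance, inferInstance, N, 0, 0, 0, 0, fun _ => 0, ⟨hN, ?_, ?_, ?_, ?_, ?_, ?_⟩, ?_⟩
    · intro i j; exact j.elim
    · intro i j; exact i.elim
    · intro i j; exact i.elim
    · intro i j; exact i.elim
    · ext i j; exact i.elim
    · simp
    · exact GSSE.tri hN mem_zero' mem_zero' (fun _ => 0) (fun i j => i.elim)
  · have h1 := isUnit_charpolyRev_of_isNilpotent hnil
    have h2 := eval_charpolyRev (M := N)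
    obtain ⟨r, hr, hr'⟩ := Polynomial.isUnit_iff.mp h1
    rw [← hr'] at h2
    have : N.charpolyRev = 1 := by
      rw [← hr']; simp at h2; simp [h2]
    exact this
  · intro m hm i j; rw [hco, if_neg (by omega)]
  · intro m hm i j; rw [hco, if_neg (by omega)]
  · intro m i j
    rw [hco]
    split_ifs
    · exact hsm i j
    · simpa using hη

theorem trace_coeff_zero {n k : ℕ} (hk : 0 < k) (A : Matrix (Fin n) (Fin n) ℝ[X])
    (hdet : det (1 - A) = 1) (hlow : ∀ m, m < k → ∀ i j, (A i j).coeff m = 0) :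
    ∑ i, (A i i).coeff k = 0 := by
  have hdvd : ∀ i j, ∃ q, A i j = X ^ k * q := fun i j =>
    Polynomial.X_pow_dvd_iff.mpr fun m hm => hlow m hm i j
  choose B hB using hdvd
  have hA : (1 - A) = 1 + (X ^ k : ℝ[X]) • (- (of B : Matrix (Fin n) (Fin n) ℝ[X])) := by
    ext1 i j
    simp [hB, sub_eq_add_neg]
  rw [hA, det_one_add_smul] at hdet
  have := congrArg (fun p => p.coeff k) hdet
  simp only [coeff_add] at this
  rw [coeff_mul_X_pow', ← pow_mul, coeff_mul_X_pow', if_pos le_rfl,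
    if_neg (by omega : ¬ k * 2 ≤ k)] at this
  simp [Matrix.trace, finsetSum_coeff] at this
  rw [← this]
  refine Finset.sum_congr rfl fun i _ => ?_
  rw [hB]
  simp [coeff_X_pow_mul']

theorem op_coeff {n : ℕ} (A : Matrix (Fin n) (Fin n) ℝ[X]) (k : ℕ) (x : ℝ) (u v : Fin n → ℝ)
    (i j : Fin n) (m : ℕ) :
    ((A + (C x * X ^ k : ℝ[X]) • ((vecMulVec u v).map C * (A - 1)) : Matrix (Fin n) (Fin n) ℝ[X]) i j).coeff m =
      (A i j).coeff m + if k ≤ m then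
        x * ∑ l, u i * v l * ((A - 1) l j).coeff (m - k) else 0 := by
  simp only [Matrix.add_apply, Matrix.smul_apply, smul_eq_mul, coeff_add, Matrix.mul_apply,
    Matrix.map_apply, vecMulVec_apply]
  rw [mul_assoc, coeff_C_mul, coeff_X_pow_mul']
  split_ifs
  · simp only [finsetSum_coeff, coeff_C_mul]
  · simp

theorem Stage.op {S : Subring ℝ} {n k : ℕ} (hk : 0 < k)
    {cond cond' : Matrix (Fin n) (Fin n) ℝ → Prop} (H : Stage S n k cond) (p q : Fin n)
    (u v : Fin n → ℝ) (hu : ∀ i, u i ∈ S) (hv : ∀ i, v i ∈ S) (huv : ∑ i, v i * u i = 0)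
    (hu1 : ∀ i, |u i| ≤ 1) (hv1 : ∀ i, |v i| ≤ 1)
    (hcond : ∀ Z, cond Z → cond' (Z - Z p q • vecMulVec u v)) : Stage S n k cond' := by
  obtain ⟨D, hD⟩ := H
  refine ⟨D + k, fun η hη => ?_⟩
  have hn0 : (0 : ℝ) ≤ n := Nat.cast_nonneg n
  obtain ⟨δ, hδ, hmain⟩ := hD (min 1 (η / (2 * n + 2))) (lt_min one_pos (by positivity))
  refine ⟨δ, hδ, fun N hN hnil hsm => ?_⟩
  obtain ⟨A, hrep, hdet, hlow, hhigh, hbd, hc⟩ := hmain N hN hnil hsm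
  set x := (A p q).coeff k with hx
  refine ⟨_, hrep.op k hk x (hrep.coeff_mem _ _ _) u v hu hv huv, ?_, ?_, ?_, ?_, ?_⟩
  · have h1 : 1 - (A + (C x * X ^ k) • ((vecMulVec u v).map C * (A - 1))) =
        (1 + (C x * X ^ k : ℝ[X]) • (vecMulVec u v).map C) * (1 - A) := by
      rw [add_mul, one_mul, Matrix.smul_mul, ← neg_sub A 1, Matrix.mul_neg, smul_neg]
      abel
    have h2 : (C x * X ^ k : ℝ[X]) • (vecMulVec u v).map C =
        replicateCol Unit (fun i => C x * X ^ k * C (u i)) * replicateRow Unit (fun i => C (v i)) := by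
      ext1 i j
      simp [Matrix.mul_apply, vecMulVec_apply]; ring
    rw [h1, det_mul, hdet, mul_one, h2, det_one_add_replicateCol_mul_replicateRow]
    have h3 : (fun i => C (v i)) ⬝ᵥ (fun i => C x * X ^ k * C (u i)) =
        C x * X ^ k * C (∑ i, v i * u i) := by
      simp only [dotProduct, map_sum, Finset.mul_sum, map_mul]
      exact Finset.sum_congr rfl fun i _ => by ring
    rw [h3, huv]; simp
  · intro m hm i j
    rw [op_coeff, hlow m hm, if_neg (by omega), add_zero]
  · intro m hm i j
    rw [op_coeff, hhigh m (by omega), if_pos (by omega), zero_add]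
    rw [Finset.sum_eq_zero, mul_zero]
    intro l _
    rw [Matrix.sub_apply, coeff_sub, hhigh _ (by omega)]
    have : ((1 : Matrix (Fin n) (Fin n) ℝ[X]) l j).coeff (m - k) = 0 := by
      rw [Matrix.one_apply]
      split_ifs
      · rw [coeff_one, if_neg (by omega)]
      · simp
    rw [this]; simp
  · intro m i j
    rw [op_coeff]
    set η0 := min 1 (η / (2 * n + 2)) with hη0
    have h0 : 0 < η0 := lt_min one_pos (by positivity)
    have hle : η0 ≤ 1 := min_le_left _ _
    have hle2 : η0 * (2 * n + 2) ≤ η := by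
      have := min_le_right 1 (η / (2 * n + 2))
      rw [← hη0, le_div_iff₀ (by positivity)] at this
      exact this
    have hterm : ∀ l, |u i * v l * ((A - 1) l j).coeff (m - k)| ≤ 2 := by
      intro l
      have e1 : |((A - 1) l j).coeff (m - k)| ≤ 2 := by
        rw [Matrix.sub_apply, coeff_sub]
        refine (abs_sub _ _).trans ?_
        have e2 : |((1 : Matrix (Fin n) (Fin n) ℝ[X]) l j).coeff (m - k)| ≤ 1 := by
          rw [Matrix.one_apply]
          split_ifs
          · rw [coeff_one]; split_ifs <;> simp
          · simp
        have := hbd (m - k) l j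
        linarith
      rw [abs_mul, abs_mul]
      have : |u i| * |v l| ≤ 1 := mul_le_one₀ (hu1 i) (abs_nonneg _) (hv1 l)
      calc |u i| * |v l| * |((A - 1) l j).coeff (m - k)| ≤ 1 * 2 := by gcongr
        _ = 2 := by norm_num
    have hsum : |∑ l, u i * v l * ((A - 1) l j).coeff (m - k)| ≤ 2 * n := by
      refine (Finset.abs_sum_le_sum_abs _ _).trans ?_
      refine (Finset.sum_le_sum fun l _ => hterm l).trans ?_
      simp [mul_comm]
    have hA := hbd m i j
    have hxb : |x| ≤ η0 := (hbd k p q).le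
    have : |(if k ≤ m then x * ∑ l, u i * v l * ((A - 1) l j).coeff (m - k) else 0)| ≤
        η0 * (2 * n) := by
      split_ifs
      · rw [abs_mul]; gcongr
      · simp; positivity
    have h4 := abs_add_le ((A i j).coeff m)
      (if k ≤ m then x * ∑ l, u i * v l * ((A - 1) l j).coeff (m - k) else 0)
    nlinarith
  · have : (of fun i j => ((A + (C x * X ^ k : ℝ[X]) • ((vecMulVec u v).map C * (A - 1)) : Matrix (Fin n) (Fin n) ℝ[X]) i j).coeff k) =
        (of fun i j => (A i j).coeff k) - (of fun i j => (A i j).coeff k) p q • vecMulVec u v := by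
      ext i j
      rw [of_apply, op_coeff, if_pos le_rfl]
      simp only [Matrix.sub_apply, of_apply, Matrix.smul_apply, vecMulVec_apply, smul_eq_mul,
        Nat.sub_self, coeff_sub, ← hx, hlow 0 hk, zero_sub]
      rw [sub_eq_add_neg]
      congr 1
      rw [← mul_neg]
      congr 1
      rw [Finset.sum_eq_single j]
      · simp
      · intro l _ hl
        simp [Matrix.one_apply, hl]
      · simp
    rw [this]
    exact hcond _ hc

theorem Stage.mono {S : Subring ℝ} {n k : ℕ} (hk : 0 < k)
    {cond cond' : Matrix (Fin n) (Fin n) ℝ → Prop} (H : Stage S n k cond)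
    (hcond : ∀ Z : Matrix (Fin n) (Fin n) ℝ, ∑ i, Z i i = 0 → cond Z → cond' Z) :
    Stage S n k cond' := by
  obtain ⟨D, hD⟩ := H
  refine ⟨D, fun η hη => ?_⟩
  obtain ⟨δ, hδ, hmain⟩ := hD η hη
  refine ⟨δ, hδ, fun N hN hnil hsm => ?_⟩
  obtain ⟨A, hrep, hdet, hlow, hhigh, hbd, hc⟩ := hmain N hN hnil hsm
  exact ⟨A, hrep, hdet, hlow, hhigh, hbd, hcond _ (trace_coeff_zero hk A hdet hlow) hc⟩

theorem Stage.next {S : Subring ℝ} {n k : ℕ} (hn : 0 < n) (hk : 0 < k)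
    (H : Stage S n k (fun _ => True)) : Stage S n (k + 1) (fun _ => True) := by
  let i0 : Fin n := ⟨0, hn⟩
  have single_mem : ∀ i j : Fin n, (Pi.single i (1 : ℝ) : Fin n → ℝ) j ∈ S := by
    intro i j
    rw [Pi.single_apply]
    split_ifs
    · exact S.one_mem
    · exact S.zero_mem
  have h1 : ∀ s : Finset (Fin n), Stage S n k (fun Z => ∀ i ∈ s, i ≠ i0 → Z i i = 0) := by
    intro s
    induction s using Finset.induction_on with
    | empty => exact H.mono hk (by simp)
    | insert p s hp ih =>
      by_cases hp0 : p = i0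
      · refine ih.mono hk fun Z _ hZ i hi hi0 => ?_
        rcases Finset.mem_insert.mp hi with rfl | hi
        · exact absurd hp0 hi0
        · exact hZ i hi hi0
      · refine ih.op hk p p (Pi.single p 1 - Pi.single i0 1) (Pi.single p 1 + Pi.single i0 1)
          (fun i => S.sub_mem (single_mem _ _) (single_mem _ _))
          (fun i => S.add_mem (single_mem _ _) (single_mem _ _)) ?_ ?_ ?_ ?_
        · have : ∀ i, ((Pi.single p 1 + Pi.single i0 1 : Fin n → ℝ) i) *
            ((Pi.single p 1 - Pi.single i0 1 : Fin n → ℝ) i) =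
            (Pi.single p 1 : Fin n → ℝ) i - (Pi.single i0 1 : Fin n → ℝ) i := by
            intro i
            simp only [Pi.add_apply, Pi.sub_apply, Pi.single_apply]
            split_ifs <;> norm_num
          rw [Finset.sum_congr rfl fun i _ => this i, Finset.sum_sub_distrib]
          simp
        · intro i
          simp only [Pi.sub_apply, Pi.single_apply]
          split_ifs <;> norm_num
        · intro i
          simp only [Pi.add_apply, Pi.single_apply]
          split_ifs with ha hb
          · exact absurd (ha.symm.trans hb) hp0
          all_goals norm_num
        · intro Z hZ i hi hi0
          simp only [Matrix.sub_apply, Matrix.smul_apply, vecMulVec_apply, Pi.sub_apply,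
            Pi.add_apply, Pi.single_apply, smul_eq_mul, hi0, if_false]
          by_cases hip : i = p
          · subst hip; simp
          · simp only [hip, if_false]
            simp [hZ i ((Finset.mem_insert.mp hi).resolve_left hip) hi0]
  have h2 : Stage S n k (fun Z => ∀ i, Z i i = 0) := by
    refine (h1 Finset.univ).mono hk fun Z htr hZ i => ?_
    by_cases hi : i = i0
    · rw [Finset.sum_eq_single i0 (fun j _ hj => hZ j (Finset.mem_univ _) hj) (by simp)] at htr
      rw [hi, htr]
    · exact hZ i (Finset.mem_univ _) hi
  have h3 : ∀ s : Finset (Fin n × Fin n), Stage S n k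
      (fun Z => (∀ i, Z i i = 0) ∧ ∀ p ∈ s, Z p.1 p.2 = 0) := by
    intro s
    induction s using Finset.induction_on with
    | empty => exact h2.mono hk (by simp)
    | insert p s hp ih =>
      obtain ⟨p, q⟩ := p
      by_cases hpq : p = q
      · refine ih.mono hk fun Z _ hZ => ⟨hZ.1, fun r hr => ?_⟩
        rcases Finset.mem_insert.mp hr with rfl | hr
        · subst hpq; exact hZ.1 _
        · exact hZ.2 r hr
      · have habs : ∀ i j : Fin n, |(Pi.single i (1 : ℝ) : Fin n → ℝ) j| ≤ 1 := by
          intro i j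
          rw [Pi.single_apply]
          split_ifs <;> norm_num
        refine ih.op hk p q (Pi.single p 1) (Pi.single q 1) (single_mem _) (single_mem _) ?_
          (habs _) (habs _) ?_
        · simp [Pi.single_apply, hpq, Ne.symm hpq]
        · rintro Z ⟨hZ1, hZ2⟩
          refine ⟨fun i => ?_, fun r hr => ?_⟩
          · simp only [Matrix.sub_apply, Matrix.smul_apply, vecMulVec_apply, Pi.single_apply,
              smul_eq_mul, hZ1]
            by_cases h1 : i = p
            · have : i ≠ q := fun h => hpq (h1.symm.trans h)
              simp [this]
            · simp [h1]
          · simp only [Matrix.sub_apply, Matrix.smul_apply, vecMulVec_apply, Pi.single_apply,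
              smul_eq_mul]
            by_cases h1 : r = (p, q)
            · subst h1; simp
            · rw [hZ2 r ((Finset.mem_insert.mp hr).resolve_left h1)]
              by_cases h2 : r.1 = p
              · have : r.2 ≠ q := fun h => h1 (Prod.ext h2 h)
                simp [this]
              · simp [h2]
  obtain ⟨D, hD⟩ := h3 Finset.univ
  refine ⟨D, fun η hη => ?_⟩
  obtain ⟨δ, hδ, hmain⟩ := hD η hη
  refine ⟨δ, hδ, fun N hN hnil hsm => ?_⟩
  obtain ⟨A, hrep, hdet, hlow, hhigh, hbd, hc⟩ := hmain N hN hnil hsm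
  refine ⟨A, hrep, hdet, fun m hm i j => ?_, hhigh, hbd, trivial⟩
  rcases Nat.lt_succ_iff_lt_or_eq.mp hm with hm | rfl
  · exact hlow m hm i j
  · exact hc.2 (i, j) (Finset.mem_univ _)

theorem stage_all (S : Subring ℝ) {n : ℕ} (hn : 0 < n) (k : ℕ) :
    Stage S n (k + 1) (fun _ => True) := by
  induction k with
  | zero => exact stage_one S n
  | succ k ih => exact ih.next hn (Nat.succ_pos k)

theorem lin_small {S : Subring ℝ} {n D : ℕ} (A : Matrix (Fin n) (Fin n) ℝ[X])
    (hA : ∀ m i j, (A i j).coeff m ∈ S) (cs ws : Bool → ℝ) (hcs : ∀ s, cs s ∈ S)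
    (hws : ∀ s, ws s ∈ S) (hsum : ∑ s, ws s * cs s ^ D = 1)
    (hlow : ∀ m, m < 2 → ∀ i j, (A i j).coeff m = 0)
    (hhigh : ∀ m, D < m → ∀ i j, (A i j).coeff m = 0) :
    Lin S (0 : Matrix (Fin n) (Fin n) ℝ)
      (of fun i (t : Bool × Fin D × Fin n) =>
        ws t.1 * cs t.1 ^ (D - 1 - t.2.1) * (A i t.2.2).coeff (t.2.1 + 2))
      (of fun (t : Bool × Fin D × Fin n) i => if (t.2.1 : ℕ) = 0 ∧ t.2.2 = i then cs t.1 else 0)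
      (of fun (t t' : Bool × Fin D × Fin n) =>
        if t.1 = t'.1 ∧ (t'.2.1 : ℕ) + 1 = t.2.1 ∧ t.2.2 = t'.2.2 then cs t.1 else 0)
      A
      (of fun (t : Bool × Fin D × Fin n) i =>
        if t.2.2 = i then (C (cs t.1) * X) ^ ((t.2.1 : ℕ) + 1) else 0)
      (fun t => t.2.1) where
  ha := fun i j => S.zero_mem
  hb := fun i j => S.mul_mem (S.mul_mem (hws _) (S.pow_mem (hcs _) _)) (hA _ _ _)
  hc := fun i j => by
    simp only [of_apply]
    split_ifs
    · exact hcs _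
    · exact S.zero_mem
  he := fun i j => by
    simp only [of_apply]
    split_ifs
    · exact hcs _
    · exact S.zero_mem
  hh := fun i j hij => by
    simp only [of_apply] at hij
    have := (ite_ne_right_iff.mp hij).1.2.1
    show (j.2.1 : ℕ) < i.2.1
    omega
  hW := by
    ext1 t i
    obtain ⟨s, ⟨j, hj⟩, l⟩ := t
    simp only [of_apply, Matrix.smul_apply, Matrix.add_apply, Matrix.map_apply, Matrix.mul_apply,
      smul_eq_mul]
    rcases j with _ | j
    · rw [Finset.sum_eq_zero]
      · by_cases h : l = i
        · simp [h, X_mul_C]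
        · simp [h]
      · intro x _
        rw [if_neg (by simp)]
        simp
    · rw [Finset.sum_eq_single (s, ⟨j, by omega⟩, l)]
      · by_cases h : l = i
        · simp [h]; ring
        · simp [h]
      · rintro ⟨s', ⟨j', hj'⟩, l'⟩ _ hne
        rw [if_neg, map_zero, zero_mul]
        rintro ⟨h1, h2, h3⟩
        apply hne
        simp only at h1 h2 h3
        have : j' = j := by omega
        subst this h1 h3
        rfl
      · simp
  hA := by
    ext1 i l
    simp only [of_apply, Matrix.smul_apply, Matrix.add_apply, Matrix.map_apply, Matrix.mul_apply,
      smul_eq_mul, Matrix.zero_apply, map_zero, zero_add, Fintype.sum_prod_type, mul_ite, mul_zero,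
      Finset.sum_ite_eq', Finset.mem_univ, if_true]
    rw [Finset.sum_comm]
    have hdeg : (A i l).natDegree < D + 2 := by
      refine Nat.lt_of_le_of_lt (natDegree_le_iff_coeff_eq_zero.mpr fun m hm => hhigh m hm i l) ?_
      omega
    conv_lhs => rw [as_sum_range' (A i l) (D + 2) hdeg]
    rw [Finset.sum_range_succ', Finset.sum_range_succ', hlow 0 (by omega), hlow (0 + 1) (by omega),
      monomial_zero_right, monomial_zero_right, add_zero, add_zero, Finset.mul_sum,
      Finset.sum_range]
    refine Finset.sum_congr rfl fun j _ => ?_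
    have h1 : ∀ s, C (ws s * cs s ^ (D - 1 - (j : ℕ)) * (A i l).coeff (j + 2)) *
        (C (cs s) * X) ^ ((j : ℕ) + 1) =
        C (ws s * cs s ^ D) * (C ((A i l).coeff (j + 2)) * X ^ ((j : ℕ) + 1)) := by
      intro s
      have : cs s ^ D = cs s ^ (D - 1 - (j : ℕ)) * cs s ^ ((j : ℕ) + 1) := by
        rw [← pow_add]
        congr 1
        have := j.2
        omega
      rw [this]
      simp only [C_mul, C_pow, mul_pow, pow_add]
      ring
    rw [Finset.sum_congr rfl fun s _ => h1 s, ← Finset.sum_mul, ← map_sum, hsum, C_1, one_mul,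
      ← C_mul_X_pow_eq_monomial]
    ring

theorem pow_potential {T : Type} [Fintype T] [DecidableEq T] (P : Matrix T T ℝ) (φ : T → ℕ) (K : ℕ)
    (h : ∀ v w, P v w ≠ 0 → φ w + 1 = φ v ∨ φ v + (K + 1) ≤ φ w + 1) (k : ℕ) :
    ∀ v w, (P ^ k) v w ≠ 0 → φ w + k = φ v ∨ φ v + (K + 1) ≤ φ w + k := by
  induction k with
  | zero =>
    intro v w hvw
    rw [pow_zero, Matrix.one_apply] at hvw
    have := (ite_ne_right_iff.mp hvw).1
    subst this
    simp
  | succ k ih =>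
    intro v w hvw
    rw [pow_succ, Matrix.mul_apply] at hvw
    obtain ⟨x, -, hx⟩ := Finset.exists_ne_zero_of_sum_ne_zero hvw
    have h1 := ih v x (left_ne_zero_of_mul hx)
    have h2 := h x w (right_ne_zero_of_mul hx)
    omega

theorem trace_potential {T : Type} [Fintype T] [DecidableEq T] (P : Matrix T T ℝ) (φ : T → ℕ)
    (K : ℕ) (h : ∀ v w, P v w ≠ 0 → φ w + 1 = φ v ∨ φ v + (K + 1) ≤ φ w + 1) (k : ℕ)
    (hk1 : 1 ≤ k) (hk : k ≤ K) : (P ^ k).trace = 0 := by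
  refine Finset.sum_eq_zero fun i _ => ?_
  by_contra hne
  have := pow_potential P φ K h k i i hne
  omega

theorem exists_coprime_small (S : Subring ℝ) (hS : Dense (S : Set ℝ)) (D : ℕ) {ε : ℝ}
    (hε : 0 < ε) : ∃ cs ws : Bool → ℝ, (∀ s, cs s ∈ S) ∧ (∀ s, ws s ∈ S) ∧
      (∀ s, |cs s| ≤ ε) ∧ (∀ s, |cs s| ≤ 1) ∧ ∑ s, ws s * cs s ^ D = 1 := by
  obtain ⟨c, hcS, hc0, hc1⟩ := hS.exists_between (lt_min hε one_pos)
  have hcε := hc1.le.trans (min_le_left _ _)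
  have hc1' := hc1.le.trans (min_le_right _ _)
  set m := ⌊1 / c⌋ with hm
  have hr0 : 0 ≤ 1 - m * c := by
    have := Int.floor_le (1 / c)
    rw [← hm, le_div_iff₀ hc0] at this
    linarith
  have hr1 : 1 - m * c ≤ c := by
    have := (Int.lt_floor_add_one (1 / c))
    rw [← hm, div_lt_iff₀ hc0] at this
    linarith
  have hmS : (m : ℝ) ∈ S := intCast_mem S m
  have hrS : 1 - m * c ∈ S := S.sub_mem S.one_mem (S.mul_mem hmS hcS)
  have hco : IsCoprime (⟨c, hcS⟩ : S) ⟨1 - m * c, hrS⟩ :=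
    ⟨⟨m, hmS⟩, 1, by ext; simp⟩
  obtain ⟨a, b, hab⟩ := hco.pow (m := D) (n := D)
  have hab' := congrArg (Subtype.val) hab
  refine ⟨fun s => cond s c (1 - m * c), fun s => cond s a b, ?_, ?_, ?_, ?_, ?_⟩
  · rintro (_ | _)
    exacts [hrS, hcS]
  · rintro (_ | _)
    exacts [b.2, a.2]
  · rintro (_ | _)
    · simp only [cond_false, abs_of_nonneg hr0]; linarith
    · simp only [cond_true, abs_of_pos hc0]; linarith
  · rintro (_ | _)
    · simp only [cond_false, abs_of_nonneg hr0]; linarith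
    · simp only [cond_true, abs_of_pos hc0]; linarith
  · simpa using hab'

theorem main_aux (S : Subring ℝ) (hS : Dense (S : Set ℝ))
    {n K : ℕ} (hn : 0 < n) (hK : 0 < K) :
    ∃ J : ℕ, 0 < J ∧ ∀ ε : ℝ, 0 < ε → ∃ δ : ℝ, 0 < δ ∧
      ∀ N : Matrix (Fin n) (Fin n) ℝ, entriesIn (S : Set ℝ) N → IsNilpotent N →
        matNormInf N < δ →
        ∃ M : Matrix (Fin J) (Fin J) ℝ, entriesIn (S : Set ℝ) M ∧
          IsSSE (S : Set ℝ) M N ∧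
          (∀ k : ℕ, 1 ≤ k → k ≤ K → ((M.map fun x => |x|) ^ k).trace = 0) ∧
          matNormInf M < ε := by
  obtain ⟨D, hD⟩ := stage_all S hn K
  have f : Fin (Fintype.card (Fin n ⊕ Bool × Fin D × Fin n)) ≃ Fin n ⊕ Bool × Fin D × Fin n :=
    (Fintype.equivFin _).symm
  refine ⟨Fintype.card (Fin n ⊕ Bool × Fin D × Fin n),
    Fintype.card_pos_iff.mpr ⟨Sum.inl ⟨0, hn⟩⟩, fun ε hε => ?_⟩
  obtain ⟨cs, ws, hcs, hws, hcε, hc1, hsum⟩ := exists_coprime_small S hS D (half_pos hε)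
  set B := |ws true| + |ws false| + 1 with hB
  have hB0 : 0 < B := by positivity
  obtain ⟨δ, hδ, hmain⟩ := hD (ε / 2 / B) (by positivity)
  refine ⟨δ, hδ, fun N hN hnil hsm => ?_⟩
  have hNsm : ∀ i j, |N i j| < δ := by
    intro i j
    refine lt_of_le_of_lt ?_ hsm
    unfold matNormInf
    exact (le_ciSup (f := fun j => |N i j|) (Set.finite_range _).bddAbove j).trans
      (le_ciSup (f := fun i => ⨆ j, |N i j|) (Set.finite_range _).bddAbove i)
  obtain ⟨A, hrep, hdet, hlow, hhigh, hbd, -⟩ := hmain N hN hnil hNsm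
  have hlin := lin_small (D := D) A hrep.coeff_mem cs ws hcs hws hsum
    (fun m hm => hlow m (by omega)) hhigh
  obtain ⟨I, _, _, a, b, c, e, W, h, hl, hs⟩ := hrep
  have hG := (hlin.unique hl).trans hs
  have hSSE := hG _ _ f (Equiv.refl _)
  simp only [Equiv.coe_refl, Matrix.submatrix_id_id] at hSSE
  have hbig := mem_fromBlocks hlin.ha hlin.hb hlin.hc hlin.he
  refine ⟨_, ?_, hSSE, ?_, ?_⟩
  · intro i j
    exact hbig _ _
  · intro k hk1 hk
    refine trace_potential _ (fun v => Sum.elim (fun _ => 0) (fun t => (t.2.1 : ℕ) + 1) (f v))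
      K ?_ k hk1 hk
    intro v w
    simp only [Matrix.map_apply, Matrix.submatrix_apply, ne_eq, abs_eq_zero]
    rcases f v with i | ⟨s, j, l⟩ <;> rcases f w with i' | ⟨s', j', l'⟩
    · simp
    · simp only [fromBlocks_apply₁₂, of_apply, Sum.elim_inl, Sum.elim_inr]
      intro hne
      right
      by_contra hlt
      exact hne (by rw [hlow _ (by omega), mul_zero])
    · simp only [fromBlocks_apply₂₁, of_apply, Sum.elim_inl, Sum.elim_inr]
      intro hne
      left
      have := (ite_ne_right_iff.mp hne).1.1
      omega
    · simp only [fromBlocks_apply₂₂, of_apply, Sum.elim_inr]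
      intro hne
      left
      have := (ite_ne_right_iff.mp hne).1.2.1
      omega
  · refine lt_of_le_of_lt (b := ε / 2) ?_ (by linarith)
    unfold matNormInf
    refine Real.iSup_le (fun v => Real.iSup_le (fun w => ?_) (by positivity)) (by positivity)
    simp only [Matrix.submatrix_apply]
    rcases f v with i | ⟨s, j, l⟩ <;> rcases f w with i' | ⟨s', j', l'⟩
    · simp; positivity
    · simp only [fromBlocks_apply₁₂, of_apply]
      rw [abs_mul, abs_mul, abs_pow]
      have h1 : |cs s'| ^ (D - 1 - (j' : ℕ)) ≤ 1 := pow_le_one₀ (abs_nonneg _) (hc1 _)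
      have h2 : |ws s'| ≤ B := by
        have := abs_nonneg (ws true)
        have := abs_nonneg (ws false)
        cases s' <;> linarith
      calc |ws s'| * |cs s'| ^ (D - 1 - (j' : ℕ)) * |(A i l').coeff (j' + 2)|
          ≤ B * 1 * (ε / 2 / B) := by
            gcongr
            exact (hbd _ _ _).le
        _ = ε / 2 := by field_simp
    · simp only [fromBlocks_apply₂₁, of_apply]
      split_ifs
      · exact hcε _
      · simp; positivity
    · simp only [fromBlocks_apply₂₂, of_apply]
      split_ifs
      · exact hcε _
      · simp; positivity

end SSEProof

/-- Let `R` be a dense subring of `ℝ` and `n, K` positive integers.  Then there is `J`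
such that for every `ε > 0` there is `δ > 0` so that every nilpotent `n × n` matrix `N`
over `R` with `‖N‖∞ < δ` is strong shift equivalent over `R` to a `J × J` matrix `M`
over `R` with `trace |M|ᵏ = 0` for `1 ≤ k ≤ K` and `‖M‖∞ < ε`. -/
theorem exists_sse_small_zero_traces (S : Subring ℝ) (hS : Dense (S : Set ℝ))
    {n K : ℕ} (hn : 0 < n) (hK : 0 < K) :
    ∃ J : ℕ, 0 < J ∧ ∀ ε : ℝ, 0 < ε → ∃ δ : ℝ, 0 < δ ∧
      ∀ N : Matrix (Fin n) (Fin n) ℝ, entriesIn (S : Set ℝ) N → IsNilpotent N →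
        matNormInf N < δ →
        ∃ M : Matrix (Fin J) (Fin J) ℝ, entriesIn (S : Set ℝ) M ∧
          IsSSE (S : Set ℝ) M N ∧
          (∀ k : ℕ, 1 ≤ k → k ≤ K → ((M.map fun x => |x|) ^ k).trace = 0) ∧
          matNormInf M < ε := by
  exact main_aux S hS hn hK
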